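/- Let R be a ring and a ∈ R. Then a has at most one generalized Hirano inverse. -/

import Mathlib

/-- `a` is quasinilpotent: `1 + a*x` is a unit for every `x` commuting with `a`. -/
def IsQuasinilpotent {R : Type*} [Ring R] (a : R) : Prop :=
  ∀ x : R, x * a = a * x → IsUnit (1 + a * x)

/-- `x` lies in the double commutant of `a`. -/
def InDoubleCommutant {R : Type*} [Ring R] (a x : R) : Prop :=
  ∀ y : R, y * a = a * y → x * y = y * x

/-- `b` is a generalized Hirano inverse of `a`. -/
def IsGHInverse {R : Type*} [Ring R] (a b : R) : Prop :=
  b * a * b = b ∧ InDoubleCommutant a b ∧ IsQuasinilpotent (a ^ 2 - a * b)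


theorem gh_aux {R : Type*} [Ring R] (a b c : R)
    (hb : IsGHInverse a b) (hc : IsGHInverse a c) : a * b = a * b * (a * c) := by
  obtain ⟨b1, b2, -⟩ := hb
  obtain ⟨c1, c2, c3⟩ := hc
  have ab : Commute a b := (b2 a rfl).symm
  have ac : Commute a c := (c2 a rfl).symm
  have bc : Commute b c := b2 c ac.symm.eq
  have ee : (a * b) * (a * b) = a * b := by rw [mul_assoc, ← mul_assoc b, b1]
  have ff : (a * c) * (a * c) = a * c := by rw [mul_assoc, ← mul_assoc c, c1]
  have af : Commute a (a * c) := (Commute.refl a).mul_right ac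
  have bf : Commute b (a * c) := ab.symm.mul_right bc
  have ef : Commute (a * b) (a * c) := af.mul_left bf
  have aq : Commute a (a ^ 2 - a * c) := ((Commute.refl a).pow_right 2).sub_right af
  have bq : Commute b (a ^ 2 - a * c) := (ab.symm.pow_right 2).sub_right bf
  have cq : Commute c (a ^ 2 - a * c) :=
    (ac.symm.pow_right 2).sub_right (ac.symm.mul_right (Commute.refl c))
  have gq : Commute (-((1 - a * c) * b ^ 2)) (a ^ 2 - a * c) :=
    ((((Commute.one_left _).sub_left (aq.mul_left cq))).mul_left (bq.pow_left 2)).neg_left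
  have hu := c3 _ gq.eq
  have fz : a * c * (1 - a * c) = 0 := by rw [mul_sub, ff, mul_one, sub_self]
  have e2 : a ^ 2 * b ^ 2 = a * b := by rw [← ab.mul_pow, pow_two, ee]
  have a2f : Commute (a ^ 2) (1 - a * c) := (Commute.one_right _).sub_right (af.pow_left 2)
  have key : (a ^ 2 - a * c) * (-((1 - a * c) * b ^ 2)) = -((1 - a * c) * (a * b)) := by
    rw [mul_neg, ← mul_assoc, sub_mul, fz, sub_zero, a2f.eq, mul_assoc, e2]
  rw [key] at hu
  have h0 : (1 + -((1 - a * c) * (a * b))) * ((1 - a * c) * (a * b)) = 0 := by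
    have h := ef.eq
    generalize a * b = e at *
    generalize a * c = f at *
    have : ((1 - f) * e) * ((1 - f) * e) = (1 - f) * e := by
      have h1 : e * (1 - f) = (1 - f) * e := by rw [mul_sub, sub_mul, h, mul_one, one_mul]
      have h2 : (1 - f) * (1 - f) = 1 - f := by rw [sub_mul, fz, one_mul, sub_zero]
      rw [mul_assoc, ← mul_assoc e, h1, mul_assoc (1 - f) e, ee, ← mul_assoc, h2]
    rw [add_mul, neg_mul, this, one_mul, add_neg_cancel]
  have h1 := (hu.mul_right_eq_zero).1 h0
  rw [sub_mul, one_mul, sub_eq_zero] at h1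
  rw [ef.eq]; exact h1

theorem stmt2 {R : Type*} [Ring R] (a b c : R)
    (hb : IsGHInverse a b) (hc : IsGHInverse a c) : b = c := by
  have h1 := gh_aux a b c hb hc
  have h2 := gh_aux a c b hc hb
  obtain ⟨b1, b2, -⟩ := hb
  obtain ⟨c1, c2, -⟩ := hc
  have ab : Commute a b := (b2 a rfl).symm
  have ac : Commute a c := (c2 a rfl).symm
  have bc : Commute b c := b2 c ac.symm.eq
  have ef : Commute (a * b) (a * c) :=
    ((Commute.refl a).mul_right ac).mul_left (ab.symm.mul_right bc)
  have e : a * b = a * c := by rw [h1, ef.eq, ← h2]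
  calc b = b * (a * b) := by rw [← mul_assoc, b1]
    _ = (b * a) * c := by rw [e, mul_assoc]
    _ = c * a * c := by rw [← ab.eq, e, ac.eq]
    _ = c := c1
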